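/- arXiv:1901.04855 — 2 statements merged into one kernel-verified Lean document; each statement's English description precedes it below -/
import Mathlib

section
/- Let m, d be natural numbers with d ≥ m+1, and let L : ℝ^d → ℝ^m be a surjective, purely irrational linear map. Then there exist a constant A depending only on L, a real constant C_L, and a function c : ℝ^m → ℝ with |c(u)| ≤ A for all u, such that: (i) for every natural number N, every ε > 0 and every v ∈ ℝ^m, | ∫_{[0,N]^d} 1_{[−ε,ε]^m}(Lx+v) dx − c(v/N) ε^m N^{d−m} | ≤ A ε^{m+1} N^{d−m−1}; and (ii) c(u) → C_L as ‖u‖_∞ → 0. -/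
open scoped Classical BigOperators
open MeasureTheory Filter

/-- Indicator function of the box `[-ε, ε]^m` in `ℝ^m`. -/
noncomputable def boxInd (m : ℕ) (ε : ℝ) (y : Fin m → ℝ) : ℝ :=
  Set.indicator {z : Fin m → ℝ | ∀ i, |z i| ≤ ε} (fun _ => 1) y

/-- Splitting of the domain along a surjective linear map, with the change of variables. -/
lemma exists_split {n m : ℕ} (L : (Fin n → ℝ) →ₗ[ℝ] (Fin m → ℝ))
    (hL : Function.Surjective L) :
    ∃ e : ((Fin m → ℝ) × (Fin (n - m) → ℝ)) ≃L[ℝ] (Fin n → ℝ),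
      (∀ p, L (e p) = p.1) ∧ ∃ D : ENNReal, D ≠ ⊤ ∧ ∀ s : Set (Fin n → ℝ),
        volume s = D * volume (e ⁻¹' s) := by
  obtain ⟨S, hS⟩ := L.exists_rightInverse_of_surjective (LinearMap.range_eq_top.2 hL)
  have hS' : ∀ w, L (S w) = w := fun w => by
    have := LinearMap.congr_fun hS w
    simpa using this
  have hr := L.finrank_range_add_finrank_ker
  rw [LinearMap.range_eq_top.2 hL, finrank_top] at hr
  simp only [Module.finrank_fin_fun] at hr
  have hk : Module.finrank ℝ (Fin (n - m) → ℝ) = Module.finrank ℝ (LinearMap.ker L) := by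
    simp only [Module.finrank_fin_fun]; omega
  let K := LinearEquiv.ofFinrankEq (Fin (n - m) → ℝ) (LinearMap.ker L) hk
  let Φ : ((Fin m → ℝ) × (Fin (n - m) → ℝ)) →ₗ[ℝ] (Fin n → ℝ) :=
    S.coprod ((LinearMap.ker L).subtype ∘ₗ K.toLinearMap)
  have hΦ : ∀ p, L (Φ p) = p.1 := by
    intro p
    have : L (K p.2 : Fin n → ℝ) = 0 := (K p.2).2
    simp [Φ, hS', this]
  have hinj : Function.Injective Φ := by
    rw [← LinearMap.ker_eq_bot, LinearMap.ker_eq_bot']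
    intro p hp
    have h1 : p.1 = 0 := by rw [← hΦ p, hp]; simp
    have h2 : p.2 = 0 := by
      simpa [Φ, h1] using hp
    exact Prod.ext h1 h2
  let e0 := LinearMap.linearEquivOfInjective Φ hinj (by
    simp only [Module.finrank_prod, Module.finrank_fin_fun]; omega)
  let e := e0.toContinuousLinearEquiv
  refine ⟨e, fun p => hΦ p, ?_⟩
  have hv : (volume : Measure ((Fin m → ℝ) × (Fin (n - m) → ℝ))).IsAddHaarMeasure := by
    exact Measure.prod.instIsAddHaarMeasure volume volume
  have hh : (Measure.map e (volume : Measure ((Fin m → ℝ) × (Fin (n - m) → ℝ)))).IsAddHaarMeasure :=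
    ContinuousLinearEquiv.isAddHaarMeasure_map e volume
  have := Measure.isAddLeftInvariant_eq_smul (volume : Measure (Fin n → ℝ)) (Measure.map e volume)
  refine ⟨((volume : Measure (Fin n → ℝ)).addHaarScalarFactor (Measure.map e volume) : NNReal),
    ENNReal.coe_ne_top, fun s => ?_⟩
  have h2 := congrArg (fun μ => μ s) this
  have h3 : Measure.map e (volume : Measure ((Fin m → ℝ) × (Fin (n - m) → ℝ))) s
      = volume (e ⁻¹' s) :=
    e.toHomeomorph.toMeasurableEquiv.map_apply s
  simp only [Measure.smul_apply] at h2
  rw [h3] at h2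
  exact h2

/-- A slab intersected with a ball has measure linear in the width. -/
lemma slab_bound {k : ℕ} (f : (Fin k → ℝ) →ₗ[ℝ] ℝ) (hf : f ≠ 0) (R : ℝ) :
    ∃ C : ℝ, 0 ≤ C ∧ ∀ a b : ℝ, a ≤ b →
      volume ({t : Fin k → ℝ | ‖t‖ ≤ R ∧ a ≤ f t ∧ f t ≤ b}) ≤ ENNReal.ofReal (C * (b - a)) := by
  let F : (Fin k → ℝ) →ₗ[ℝ] (Fin 1 → ℝ) := LinearMap.pi fun _ => f
  have hF : Function.Surjective F := by
    intro y
    obtain ⟨x, hx⟩ := LinearMap.surjective hf (y 0)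
    exact ⟨x, by ext i; fin_cases i; simpa [F] using hx⟩
  obtain ⟨e, he, D, hD, hvol⟩ := exists_split F hF
  obtain ⟨M, hM⟩ := ((isCompact_closedBall (0 : Fin k → ℝ) R).image
    e.symm.continuous).isBounded.exists_norm_le
  refine ⟨(D * volume (Metric.closedBall (0 : Fin (k - 1) → ℝ) M)).toReal, ENNReal.toReal_nonneg, ?_⟩
  intro a b hab
  rw [hvol]
  have hsub : e ⁻¹' {t : Fin k → ℝ | ‖t‖ ≤ R ∧ a ≤ f t ∧ f t ≤ b} ⊆
      (Set.Icc (fun _ => a) (fun _ => b) : Set (Fin 1 → ℝ)) ×ˢ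
        Metric.closedBall (0 : Fin (k - 1) → ℝ) M := by
    rintro p ⟨h1, h2, h3⟩
    have hp : f (e p) = p.1 0 := congrFun (he p) 0
    rw [hp] at h2 h3
    refine ⟨⟨fun i => ?_, fun i => ?_⟩, ?_⟩
    · fin_cases i; exact h2
    · fin_cases i; exact h3
    · have := hM p ⟨e p, by simpa using h1, by simp⟩
      rw [mem_closedBall_zero_iff]
      exact (norm_snd_le p).trans this
  have hfin : D * volume (Metric.closedBall (0 : Fin (k - 1) → ℝ) M) ≠ ⊤ :=
    ENNReal.mul_ne_top hD measure_closedBall_lt_top.ne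
  calc D * volume (e ⁻¹' {t : Fin k → ℝ | ‖t‖ ≤ R ∧ a ≤ f t ∧ f t ≤ b})
      ≤ D * volume ((Set.Icc (fun _ => a) (fun _ => b) : Set (Fin 1 → ℝ)) ×ˢ
        Metric.closedBall (0 : Fin (k - 1) → ℝ) M) := by gcongr
    _ = D * volume (Metric.closedBall (0 : Fin (k - 1) → ℝ) M) * ENNReal.ofReal (b - a) := by
        rw [Measure.volume_eq_prod, Measure.prod_prod, Real.volume_Icc_pi]
        simp only [Finset.univ_unique, Finset.prod_singleton]
        ring
    _ = _ := by
        rw [ENNReal.ofReal_mul ENNReal.toReal_nonneg, ENNReal.ofReal_toReal hfin]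

/-- The fibre volume function is Lipschitz. -/
lemma fibre_lipschitz {m d : ℕ} {k : ℕ}
    (e : ((Fin m → ℝ) × (Fin k → ℝ)) ≃L[ℝ] (Fin d → ℝ))
    (hK : ∀ j, ∃ t, e (0, t) j ≠ 0) :
    ∃ C : ℝ, 0 ≤ C ∧ (∀ w, volume {t | e (w, t) ∈ Set.Icc (0 : Fin d → ℝ) 1} ≤ ENNReal.ofReal C) ∧
      ∀ w w', volume {t | e (w, t) ∈ Set.Icc (0 : Fin d → ℝ) 1} ≤
        volume {t | e (w', t) ∈ Set.Icc (0 : Fin d → ℝ) 1} + ENNReal.ofReal (C * ‖w - w'‖) := by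
  obtain ⟨R, hR⟩ := ((isCompact_Icc (a := (0 : Fin d → ℝ)) (b := 1)).image
    e.symm.continuous).isBounded.exists_norm_le
  have hRt : ∀ w t, e (w, t) ∈ Set.Icc (0 : Fin d → ℝ) 1 → ‖t‖ ≤ R := by
    intro w t h
    exact (norm_snd_le (w, t)).trans (hR (w, t) ⟨_, h, by simp⟩)
  let f : Fin d → (Fin k → ℝ) →ₗ[ℝ] ℝ := fun j =>
    LinearMap.proj j ∘ₗ e.toLinearEquiv.toLinearMap ∘ₗ LinearMap.inr ℝ _ _
  have hf : ∀ j, f j ≠ 0 := by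
    intro j h
    obtain ⟨t, ht⟩ := hK j
    exact ht (LinearMap.congr_fun h t)
  have hsplit : ∀ w t j, e (w, t) j = e (w, 0) j + f j t := by
    intro w t j
    have : (w, t) = (w, 0) + (0, t) := by simp
    rw [this, map_add]; rfl
  choose C hC0 hC using fun j => slab_bound (f j) (hf j) R
  set Mn := ‖(e : ((Fin m → ℝ) × (Fin k → ℝ)) →L[ℝ] (Fin d → ℝ))‖ with hMn
  have hdiff : ∀ w w' j, |e (w, 0) j - e (w', 0) j| ≤ Mn * ‖w - w'‖ := by
    intro w w' j
    have h1 : e (w, 0) j - e (w', 0) j = e (w - w', 0) j := by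
      have : (w - w', (0 : Fin k → ℝ)) = (w, 0) - (w', 0) := by simp
      rw [this, map_sub]; rfl
    rw [h1, ← Real.norm_eq_abs]
    refine (norm_le_pi_norm _ j).trans ?_
    refine ((e : ((Fin m → ℝ) × (Fin k → ℝ)) →L[ℝ] (Fin d → ℝ)).le_opNorm _).trans ?_
    simp [Prod.norm_def, hMn]
  have hMn0 : 0 ≤ Mn := norm_nonneg _
  set C1 := ∑ j, 2 * (C j * Mn) with hC1
  have hC10 : 0 ≤ C1 := Finset.sum_nonneg fun j _ => by have := hC0 j; positivity
  set V := (volume (Metric.closedBall (0 : Fin k → ℝ) R)).toReal with hV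
  have hV0 : 0 ≤ V := ENNReal.toReal_nonneg
  refine ⟨V + C1, by positivity, ?_, ?_⟩
  · intro w
    calc _ ≤ volume (Metric.closedBall (0 : Fin k → ℝ) R) := by
          apply measure_mono
          intro t ht
          rw [mem_closedBall_zero_iff]; exact hRt w t ht
      _ = ENNReal.ofReal V := (ENNReal.ofReal_toReal measure_closedBall_lt_top.ne).symm
      _ ≤ _ := ENNReal.ofReal_le_ofReal (by linarith)
  · intro w w'
    set η := Mn * ‖w - w'‖ with hη
    have hη0 : 0 ≤ η := by positivity
    have hsub : {t | e (w, t) ∈ Set.Icc (0 : Fin d → ℝ) 1} ⊆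
        {t | e (w', t) ∈ Set.Icc (0 : Fin d → ℝ) 1} ∪
        ⋃ j, ({t | ‖t‖ ≤ R ∧ -e (w, 0) j ≤ f j t ∧ f j t ≤ -e (w, 0) j + η} ∪
          {t | ‖t‖ ≤ R ∧ 1 - e (w, 0) j - η ≤ f j t ∧ f j t ≤ 1 - e (w, 0) j}) := by
      intro t ht
      by_cases h : e (w', t) ∈ Set.Icc (0 : Fin d → ℝ) 1
      · exact Or.inl h
      right
      have hn := hRt w t ht
      have : ∃ j, e (w', t) j < 0 ∨ 1 < e (w', t) j := by
        by_contra! hc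
        exact h ⟨fun j => (hc j).1, fun j => (hc j).2⟩
      obtain ⟨j, hj⟩ := this
      refine Set.mem_iUnion.2 ⟨j, ?_⟩
      have h0 : (0 : ℝ) ≤ e (w, t) j := ht.1 j
      have h1 : e (w, t) j ≤ 1 := ht.2 j
      have hd := abs_le.1 (hdiff w w' j)
      rw [hsplit w t j] at h0 h1
      rw [hsplit w' t j] at hj
      rw [← hη] at hd
      rcases hj with hj | hj
      · left
        exact ⟨hn, by linarith, by linarith [hd.1, hd.2]⟩
      · right
        exact ⟨hn, by linarith [hd.1, hd.2], by linarith⟩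
    refine (measure_mono hsub).trans ((measure_union_le _ _).trans ?_)
    gcongr
    refine (measure_iUnion_fintype_le _ _).trans ?_
    calc _ ≤ ∑ j, ENNReal.ofReal (2 * (C j * Mn) * ‖w - w'‖) := by
          apply Finset.sum_le_sum
          intro j _
          refine (measure_union_le _ _).trans ?_
          have a1 := hC j (-e (w, 0) j) (-e (w, 0) j + η) (by linarith)
          have a2 := hC j (1 - e (w, 0) j - η) (1 - e (w, 0) j) (by linarith)
          refine (add_le_add a1 a2).trans ?_
          have := hC0 j
          rw [← ENNReal.ofReal_add (mul_nonneg this (by linarith)) (mul_nonneg this (by linarith))]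
          apply ENNReal.ofReal_le_ofReal
          rw [hη]; apply le_of_eq; ring
      _ = ENNReal.ofReal (C1 * ‖w - w'‖) := by
          rw [← ENNReal.ofReal_sum_of_nonneg, ← Finset.sum_mul]
          intro j _
          have := hC0 j
          positivity
      _ ≤ _ := by
          apply ENNReal.ofReal_le_ofReal
          have := norm_nonneg (w - w')
          nlinarith

open scoped Pointwise in
/-- The integral in terms of measures, after rescaling. -/
lemma integral_scale {m d : ℕ} (L : Matrix (Fin m) (Fin d) ℝ) (N : ℕ) (hN : 1 ≤ N) (ε : ℝ)
    (v : Fin m → ℝ) :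
    (∫ x in Set.Icc (0 : Fin d → ℝ) (fun _ => (N : ℝ)), boxInd m ε (L.mulVec x + v)) =
      (N : ℝ) ^ d * (volume {x : Fin d → ℝ | x ∈ Set.Icc (0 : Fin d → ℝ) 1 ∧
        ∀ i, |L.mulVec x i + v i / N| ≤ ε / N}).toReal := by
  have hN0 : (0 : ℝ) < N := by exact_mod_cast hN
  have hmeas : MeasurableSet {x : Fin d → ℝ | ∀ i, |(L.mulVec x + v) i| ≤ ε} := by
    apply IsClosed.measurableSet
    rw [Set.ofPred_forall]
    apply isClosed_iInter
    intro i
    apply isClosed_le _ continuous_const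
    simp only [Pi.add_apply, Matrix.mulVec, dotProduct]
    fun_prop
  have h1 : (fun x : Fin d → ℝ => boxInd m ε (L.mulVec x + v)) =
      Set.indicator {x : Fin d → ℝ | ∀ i, |(L.mulVec x + v) i| ≤ ε} 1 := by
    ext x
    simp [boxInd, Set.indicator]
  rw [h1, integral_indicator_one hmeas, measureReal_def, Measure.restrict_apply hmeas]
  have h2 : {x : Fin d → ℝ | ∀ i, |(L.mulVec x + v) i| ≤ ε} ∩
      Set.Icc (0 : Fin d → ℝ) (fun _ => (N : ℝ)) =
      (N : ℝ) • {x : Fin d → ℝ | x ∈ Set.Icc (0 : Fin d → ℝ) 1 ∧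
        ∀ i, |L.mulVec x i + v i / N| ≤ ε / N} := by
    ext x
    rw [Set.mem_smul_set_iff_inv_smul_mem₀ hN0.ne']
    simp only [Set.mem_inter_iff, Set.mem_ofPred_eq, Set.mem_Icc, Pi.le_def, Pi.zero_apply,
      Pi.one_apply, Pi.smul_apply, smul_eq_mul, Matrix.mulVec_smul, Pi.add_apply]
    have e1 : ∀ i, |(N : ℝ)⁻¹ * L.mulVec x i + v i / N| ≤ ε / N ↔ |L.mulVec x i + v i| ≤ ε := by
      intro i
      have : (N : ℝ)⁻¹ * L.mulVec x i + v i / N = (L.mulVec x i + v i) / N := by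
        field_simp
      rw [this, abs_div, abs_of_pos hN0, div_le_div_iff_of_pos_right hN0]
    have e2 : ∀ i, 0 ≤ (N : ℝ)⁻¹ * x i ↔ 0 ≤ x i := by
      intro i
      rw [mul_nonneg_iff_of_pos_left (inv_pos.2 hN0)]
    have e3 : ∀ i, (N : ℝ)⁻¹ * x i ≤ 1 ↔ x i ≤ N := by
      intro i
      rw [inv_mul_le_iff₀ hN0, mul_one]
    simp only [e1, e2, e3]
    tauto
  rw [h2, Measure.addHaar_smul, ENNReal.toReal_mul, ENNReal.toReal_ofReal (abs_nonneg _)]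
  simp

theorem stmt16 (m d : ℕ) (hm : 0 < m) (hd : m + 1 ≤ d)
    (L : Matrix (Fin m) (Fin d) ℝ)
    (hsurj : Function.Surjective L.mulVec)
    (hirr : ∀ α : Fin m → ℝ, α ≠ 0 → ∃ j, ∀ k : ℤ, Matrix.vecMul α L j ≠ (k : ℝ)) :
    ∃ A : ℝ, ∃ CL : ℝ, ∃ c : (Fin m → ℝ) → ℝ,
      (∀ u, |c u| ≤ A) ∧
      (∀ N : ℕ, 1 ≤ N → ∀ ε : ℝ, 0 < ε → ∀ v : Fin m → ℝ,
        |(∫ x in Set.Icc (0 : Fin d → ℝ) (fun _ => (N : ℝ)),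
              boxInd m ε (L.mulVec x + v))
          - c (fun i => v i / N) * ε ^ m * (N : ℝ) ^ (d - m)|
        ≤ A * ε ^ (m + 1) * (N : ℝ) ^ (d - m - 1)) ∧
      Filter.Tendsto c (nhds 0) (nhds CL) := by
  obtain ⟨e, he, D, hD, hvol⟩ := exists_split L.mulVecLin hsurj
  replace he : ∀ p, L.mulVec (e p) = p.1 := he
  have hK : ∀ j, ∃ t, e (0, t) j ≠ 0 := by
    intro j
    by_contra! hc
    let φ : (Fin m → ℝ) →ₗ[ℝ] ℝ :=
      LinearMap.proj j ∘ₗ e.toLinearEquiv.toLinearMap ∘ₗ LinearMap.inl ℝ _ _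
    let α : Fin m → ℝ := fun i => φ (Pi.single i 1)
    have hα : ∀ w, φ w = dotProduct α w := by
      intro w
      rw [LinearMap.pi_apply_eq_sum_univ φ w]
      simp only [dotProduct, α, smul_eq_mul]
      refine Finset.sum_congr rfl fun i _ => ?_
      rw [mul_comm]
      congr 2
      ext l
      simp [Pi.single_apply, eq_comm]
    have hx : ∀ x : Fin d → ℝ, x j = dotProduct (Matrix.vecMul α L) x := by
      intro x
      rw [← Matrix.dotProduct_mulVec, ← hα]
      obtain ⟨⟨w, t⟩, rfl⟩ := e.surjective x
      rw [he]
      have : (w, t) = (w, 0) + (0, t) := by simp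
      rw [this, map_add, Pi.add_apply, hc t, add_zero]
      simp [φ]
    have hv : ∀ i, Matrix.vecMul α L i = if i = j then 1 else 0 := by
      intro i
      have := hx (Pi.single i 1)
      rw [dotProduct_single, mul_one] at this
      rw [← this]
      simp [Pi.single_apply, eq_comm]
    have hα0 : α ≠ 0 := by
      intro h0
      have := hv j
      simp [h0] at this
    obtain ⟨i, hi⟩ := hirr α hα0
    by_cases hij : i = j
    · exact hi 1 (by rw [hv]; simp [hij])
    · exact hi 0 (by rw [hv]; simp [hij])
  obtain ⟨C, hC0, hCb, hCl⟩ := fibre_lipschitz e hK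
  set G : (Fin m → ℝ) → ENNReal :=
    fun w => volume {t | e (w, t) ∈ Set.Icc (0 : Fin d → ℝ) 1} with hG
  have hGt : ∀ w, G w ≠ ⊤ := fun w => ((hCb w).trans_lt ENNReal.ofReal_lt_top).ne
  set g : (Fin m → ℝ) → ℝ := fun w => (G w).toReal with hg
  have hg0 : ∀ w, 0 ≤ g w := fun w => ENNReal.toReal_nonneg
  have hgC : ∀ w, g w ≤ C := fun w => ENNReal.toReal_le_of_le_ofReal hC0 (hCb w)
  have hgl1 : ∀ w w', g w ≤ g w' + C * ‖w - w'‖ := by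
    intro w w'
    have h := ENNReal.toReal_mono (ENNReal.add_ne_top.2 ⟨hGt w', ENNReal.ofReal_ne_top⟩) (hCl w w')
    rwa [ENNReal.toReal_add (hGt w') ENNReal.ofReal_ne_top,
      ENNReal.toReal_ofReal (by positivity)] at h
  have hgl : ∀ w w', |g w - g w'| ≤ C * ‖w - w'‖ := by
    intro w w'
    rw [abs_le]
    have h1 := hgl1 w w'
    have h2 := hgl1 w' w
    rw [norm_sub_rev] at h2
    constructor <;> linarith
  have hgcont : Continuous g := by
    have : LipschitzWith (Real.toNNReal C) g := by
      apply LipschitzWith.of_dist_le_mul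
      intro x y
      rw [Real.dist_eq, dist_eq_norm, Real.coe_toNNReal C hC0]
      exact hgl x y
    exact this.continuous
  set D' := D.toReal with hD'
  have hD'0 : 0 ≤ D' := ENNReal.toReal_nonneg
  -- the key formula
  have hF : ∀ (u : Fin m → ℝ) (δ : ℝ), 0 < δ →
      (volume {x : Fin d → ℝ | x ∈ Set.Icc (0 : Fin d → ℝ) 1 ∧
        ∀ i, |L.mulVec x i + u i| ≤ δ}).toReal = D' * ∫ w in Metric.closedBall (-u) δ, g w := by
    intro u δ hδ
    rw [hvol, ENNReal.toReal_mul]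
    congr 1
    have hset : e ⁻¹' {x : Fin d → ℝ | x ∈ Set.Icc (0 : Fin d → ℝ) 1 ∧
        ∀ i, |L.mulVec x i + u i| ≤ δ} =
        e ⁻¹' (Set.Icc 0 1) ∩ Prod.fst ⁻¹' (Metric.closedBall (-u) δ) := by
      ext p
      simp only [Set.mem_preimage, Set.mem_ofPred_eq, Set.mem_inter_iff, he, mem_closedBall_iff_norm,
        sub_neg_eq_add, pi_norm_le_iff_of_nonneg hδ.le, Real.norm_eq_abs, Pi.add_apply]
    have hmeas : MeasurableSet (e ⁻¹' (Set.Icc (0 : Fin d → ℝ) 1) ∩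
        Prod.fst ⁻¹' (Metric.closedBall (-u) δ)) :=
      ((isClosed_Icc.preimage e.continuous).inter
        (Metric.isClosed_closedBall.preimage continuous_fst)).measurableSet
    rw [hset, Measure.volume_eq_prod, Measure.prod_apply hmeas]
    have hsec : ∀ w, volume (Prod.mk w ⁻¹' (e ⁻¹' (Set.Icc (0 : Fin d → ℝ) 1) ∩
        Prod.fst ⁻¹' (Metric.closedBall (-u) δ))) = (Metric.closedBall (-u) δ).indicator G w := by
      intro w
      by_cases hw : w ∈ Metric.closedBall (-u) δ
      · rw [Set.indicator_of_mem hw]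
        congr 1
        ext t
        simp only [Set.mem_preimage, Set.mem_inter_iff, Set.mem_ofPred_eq, hw, and_true]
      · rw [Set.indicator_of_notMem hw]
        have : (Prod.mk w ⁻¹' (e ⁻¹' (Set.Icc (0 : Fin d → ℝ) 1) ∩
            Prod.fst ⁻¹' (Metric.closedBall (-u) δ))) = ∅ := by
          ext t
          simp only [Set.mem_preimage, Set.mem_inter_iff, hw, and_false, Set.mem_empty_iff_false]
        rw [this, measure_empty]
    simp_rw [hsec]
    rw [lintegral_indicator Metric.isClosed_closedBall.measurableSet,
      integral_eq_lintegral_of_nonneg_ae (Eventually.of_forall hg0)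
        hgcont.aestronglyMeasurable]
    congr 2
    ext w
    exact (ENNReal.ofReal_toReal (hGt w)).symm
  have hkey : ∀ (u : Fin m → ℝ) (δ : ℝ), 0 < δ →
      |(volume {x : Fin d → ℝ | x ∈ Set.Icc (0 : Fin d → ℝ) 1 ∧
        ∀ i, |L.mulVec x i + u i| ≤ δ}).toReal - D' * 2 ^ m * g (-u) * δ ^ m| ≤
        D' * 2 ^ m * C * δ ^ (m + 1) := by
    intro u δ hδ
    rw [hF u δ hδ]
    have hvb : (volume : Measure (Fin m → ℝ)).real (Metric.closedBall (-u) δ) = (2 * δ) ^ m := by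
      rw [measureReal_def, Real.volume_pi_closedBall _ hδ.le, ENNReal.toReal_ofReal (by positivity)]
      simp
    have hint : IntegrableOn g (Metric.closedBall (-u) δ) :=
      hgcont.continuousOn.integrableOn_compact (isCompact_closedBall _ _)
    have hb : ‖∫ w in Metric.closedBall (-u) δ, (g w - g (-u))‖ ≤
        C * δ * (volume : Measure (Fin m → ℝ)).real (Metric.closedBall (-u) δ) := by
      apply norm_setIntegral_le_of_norm_le_const measure_closedBall_lt_top
      intro w hw
      refine (hgl w (-u)).trans ?_
      rw [mem_closedBall_iff_norm] at hw
      gcongr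
    rw [integral_sub hint (integrableOn_const measure_closedBall_lt_top.ne), setIntegral_const, hvb,
      Real.norm_eq_abs, smul_eq_mul] at hb
    have : D' * (∫ w in Metric.closedBall (-u) δ, g w) - D' * 2 ^ m * g (-u) * δ ^ m =
        D' * ((∫ w in Metric.closedBall (-u) δ, g w) - (2 * δ) ^ m * g (-u)) := by
      rw [mul_pow]; ring
    rw [this, abs_mul, abs_of_nonneg hD'0]
    calc _ ≤ D' * (C * δ * (2 * δ) ^ m) := by gcongr
      _ = _ := by rw [mul_pow]; ring
  refine ⟨D' * 2 ^ m * C, D' * 2 ^ m * g (-0), fun u => D' * 2 ^ m * g (-u), ?_, ?_, ?_⟩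
  · intro u
    have := hg0 (-u)
    rw [abs_of_nonneg (by positivity)]
    exact mul_le_mul_of_nonneg_left (hgC (-u)) (by positivity)
  · intro N hN ε hε v
    have hN0 : (0 : ℝ) < N := by exact_mod_cast hN
    rw [integral_scale L N hN ε v]
    have h := hkey (fun i => v i / N) (ε / N) (by positivity)
    set X := (volume {x : Fin d → ℝ | x ∈ Set.Icc (0 : Fin d → ℝ) 1 ∧
        ∀ i, |L.mulVec x i + v i / N| ≤ ε / N}).toReal
    set c := g (-fun i => v i / N)
    have p1 : (N : ℝ) ^ d = (N : ℝ) ^ (d - m) * (N : ℝ) ^ m := by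
      rw [← pow_add]; congr 1; omega
    have p2 : (N : ℝ) ^ d = (N : ℝ) ^ (d - m - 1) * (N : ℝ) ^ (m + 1) := by
      rw [← pow_add]; congr 1; omega
    have e1 : (N : ℝ) ^ d * X - D' * 2 ^ m * c * ε ^ m * (N : ℝ) ^ (d - m) =
        (N : ℝ) ^ d * (X - D' * 2 ^ m * c * (ε / N) ^ m) := by
      rw [mul_sub]
      congr 1
      rw [p1, div_pow]
      field_simp
    have e2 : D' * 2 ^ m * C * ε ^ (m + 1) * (N : ℝ) ^ (d - m - 1) =
        (N : ℝ) ^ d * (D' * 2 ^ m * C * (ε / N) ^ (m + 1)) := by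
      rw [p2, div_pow]
      field_simp
    rw [e1, e2, abs_mul, abs_of_pos (by positivity)]
    gcongr
  · have : Continuous fun u => D' * 2 ^ m * g (-u) := by fun_prop
    exact this.tendsto 0
end

section
/- Let m, d be natural numbers with d ≥ m+1, and let L : ℝ^d → ℝ^m be a surjective, purely irrational linear map such that for each of the d coordinate hyperplanes U ≤ ℝ^d (spanned by d−1 of the standard basis vectors) the restriction L|_U : U → ℝ^m is surjective. Then there exists a constant A depending only on L such that for every natural number N, every ε > 0, every δ ∈ (0,1/2), every v ∈ ℝ^m, and both sign choices s ∈ {+1,−1}, one has | ∫_{[sδN,(1−sδ)N]^d} 1_{[−ε(1−sδ),ε(1−sδ)]^m}(Lx+v) dx − ∫_{[0,N]^d} 1_{[−ε,ε]^m}(Lx+v) dx | ≤ A δ ε^m N^{d−m} + A ε^{m+1} N^{d−m−1}, where for s = −1 the domain is [−δN,(1+δ)N]^d and the box is [−ε(1+δ),ε(1+δ)]^m. -/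
open scoped Classical BigOperators
open MeasureTheory Filter

theorem exists_cols {m d : ℕ} (L : Matrix (Fin m) (Fin d) ℝ) (i : Fin d)
    (h : ∀ y : Fin m → ℝ, ∃ x : Fin d → ℝ, x i = 0 ∧ L.mulVec x = y) :
    ∃ e : Fin m → Fin d, Function.Injective e ∧ (∀ j, e j ≠ i) ∧
      LinearIndependent ℝ (fun j => L.col (e j)) := by
  obtain ⟨κ, a, ha, hspan, hli⟩ :=
    exists_linearIndependent' ℝ (fun k : {k : Fin d // k ≠ i} => L.col k.1)
  have htop : ⊤ ≤ Submodule.span ℝ (Set.range ((fun k : {k : Fin d // k ≠ i} => L.col k.1) ∘ a)) := by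
    rw [hspan]
    intro y _
    obtain ⟨x, hx, rfl⟩ := h y
    rw [Matrix.mulVec_eq_sum]
    refine Submodule.sum_mem _ fun k _ => ?_
    by_cases hk : k = i
    · subst hk; simp [hx]
    · have : L.col k ∈ Submodule.span ℝ
          (Set.range (fun k : {k : Fin d // k ≠ i} => L.col k.1)) :=
        Submodule.subset_span ⟨⟨k, hk⟩, rfl⟩
      have h2 := Submodule.smul_mem _ (x k) this
      convert h2 using 1
      ext r; simp [Matrix.transpose_apply, mul_comm]
      
  let B := Module.Basis.mk hli htop
  have : Fintype κ := Fintype.ofInjective a ha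
  have hc : Fintype.card κ = m := by
    rw [← Module.finrank_eq_card_basis B]; simp
  let f : Fin m ≃ κ := (Fintype.equivFinOfCardEq hc).symm
  refine ⟨fun j => (a (f j)).1, fun j k hjk => ?_, fun j => (a (f j)).2, ?_⟩
  · exact f.injective (ha (Subtype.ext hjk))
  · exact hli.comp f f.injective

theorem volA {m d : ℕ} (L : Matrix (Fin m) (Fin d) ℝ) (i : Fin d)
    (h : ∀ y : Fin m → ℝ, ∃ x : Fin d → ℝ, x i = 0 ∧ L.mulVec x = y) :
    ∃ C : ℝ, 0 ≤ C ∧ ∃ e : Fin m → Fin d, Function.Injective e ∧ (∀ j, e j ≠ i) ∧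
      ∀ N ε δ : ℝ, 0 ≤ N → 0 ≤ ε → 0 ≤ δ → ∀ (k0 : Fin d) (a : Fin d → ℝ) (b : Fin m → ℝ),
        volume {x : Fin d → ℝ |
          (∀ k, k ∉ Set.range e → |x k - a k| ≤ (if k = k0 then δ else 1) * (2 * N)) ∧
          ∀ j, |L.mulVec x j - b j| ≤ (if e j = k0 then δ else 1) * (2 * ε)}
        ≤ ENNReal.ofReal (C * (δ * ε ^ m * N ^ (d - m))) := by
  obtain ⟨e, he, hei, hli⟩ := exists_cols L i h
  let T : (Fin d → ℝ) →ₗ[ℝ] (Fin d → ℝ) := LinearMap.pi fun k =>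
    Function.extend e (fun j => (LinearMap.proj j : (Fin m → ℝ) →ₗ[ℝ] ℝ) ∘ₗ L.mulVecLin)
      (fun k => LinearMap.proj k) k
  have hT1 : ∀ x j, T x (e j) = L.mulVec x j := by
    intro x j
    simp [T, he.extend_apply]
  have hT2 : ∀ x k, k ∉ Set.range e → T x k = x k := by
    intro x k hk
    simp only [T, LinearMap.pi_apply]
    rw [Function.extend_apply' _ _ _ (by simpa using hk)]
    simp
  have hinj : LinearMap.ker T = ⊥ := by
    rw [LinearMap.ker_eq_bot']
    intro x hx
    have h0 : ∀ k, k ∉ Set.range e → x k = 0 := fun k hk => by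
      rw [← hT2 x k hk, hx]; rfl
    have hL : L.mulVec x = 0 := by
      ext j; rw [← hT1, hx]; rfl
    have hs : ∑ j, x (e j) • L.col (e j) = 0 := by
      rw [← hL]
      ext r
      simp only [Matrix.mulVec, dotProduct, Finset.sum_apply, Pi.smul_apply, Matrix.col_apply,
        smul_eq_mul]
      rw [← Finset.sum_image (s := Finset.univ) (g := e) (f := fun k => x k * L r k)
        (fun _ _ _ _ h => he h)]
      rw [Finset.sum_subset (Finset.subset_univ _)]
      · exact Finset.sum_congr rfl fun _ _ => mul_comm _ _
      · intro k _ hk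
        rw [h0 k (by simpa using hk), zero_mul]
    have h1 := Fintype.linearIndependent_iff.1 hli _ hs
    ext k
    by_cases hk : k ∈ Set.range e
    · obtain ⟨j, rfl⟩ := hk; exact h1 j
    · exact h0 k hk
  have hdet : LinearMap.det T ≠ 0 := by
    intro h0
    exact absurd hinj (LinearMap.bot_lt_ker_of_det_eq_zero h0).ne'
  refine ⟨|(LinearMap.det T)⁻¹| * 4 ^ d, by positivity, e, he, hei, ?_⟩
  intro N ε δ hN hε hδ k0 a b
  let c : Fin d → ℝ := Function.extend e b a
  let R : Fin d → ℝ := fun k => if k ∈ Finset.univ.image e then ε else N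
  let r : Fin d → ℝ := fun k => (if k = k0 then δ else 1) * (2 * R k)
  have hprod : ∏ k, (2 * r k) = 4 ^ d * (δ * ε ^ m * N ^ (d - m)) := by
    have : ∀ k, 2 * r k = (if k = k0 then δ else 1) * (4 * R k) := fun k => by
      simp only [r]; ring
    simp only [this]
    rw [Finset.prod_mul_distrib, Finset.prod_mul_distrib, Finset.prod_ite_eq' Finset.univ k0]
    simp only [R, Finset.prod_ite, Finset.prod_const]
    have h1 : (Finset.univ.filter (fun k => k ∈ Finset.univ.image e)).card = m := by
      rw [Finset.filter_mem_eq_inter, Finset.univ_inter, Finset.card_image_of_injective _ he]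
      simp
    have h2 : (Finset.univ.filter (fun k => k ∉ Finset.univ.image e)).card = d - m := by
      rw [Finset.filter_not, Finset.card_sdiff_of_subset (Finset.filter_subset _ _), h1]; simp
    rw [h1, h2]
    simp; ring
  calc _ ≤ volume (T ⁻¹' (Set.Icc (fun k => c k - r k) (fun k => c k + r k))) := by
        apply measure_mono
        rintro x ⟨hx1, hx2⟩
        have : ∀ k, |T x k - c k| ≤ r k := by
          intro k
          by_cases hk : k ∈ Set.range e
          · obtain ⟨j, rfl⟩ := hk
            have := hx2 j
            simpa [hT1, c, r, R, he.extend_apply] using this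
          · have := hx1 k hk
            have hc : c k = a k := Function.extend_apply' _ _ _ (by simpa using hk)
            have hR : R k = N := by
              simp only [R]; rw [if_neg (by simpa using hk)]
            simpa only [hT2 x k hk, hc, r, hR] using this
        refine ⟨fun k => ?_, fun k => ?_⟩
        · have := (abs_le.1 (this k)).1
          show c k - r k ≤ T x k
          linarith
        · have := (abs_le.1 (this k)).2
          show T x k ≤ c k + r k
          linarith
    _ = _ := by
        rw [Measure.addHaar_preimage_linearMap _ hdet, Real.volume_Icc_pi,
          ← ENNReal.ofReal_prod_of_nonneg, ← ENNReal.ofReal_mul (abs_nonneg _)]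
        · congr 1
          rw [mul_assoc, ← hprod]
          congr 1
          exact Finset.prod_congr rfl fun k _ => by ring
        · intro k _
          have : 0 ≤ r k := by
            simp only [r, R]; positivity
          linarith

theorem volB {m d : ℕ} (L : Matrix (Fin m) (Fin d) ℝ) (i : Fin d)
    (h : ∀ y : Fin m → ℝ, ∃ x : Fin d → ℝ, x i = 0 ∧ L.mulVec x = y) :
    ∃ C : ℝ, 0 ≤ C ∧
      ∀ N ε δ : ℝ, 0 ≤ N → 0 ≤ ε → 0 ≤ δ → ∀ (a : ℝ) (b : Fin m → ℝ),
        volume {x : Fin d → ℝ | (∀ k, |x k - N / 2| ≤ 2 * N) ∧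
          (∀ j, |L.mulVec x j - b j| ≤ 2 * ε) ∧ |x i - a| ≤ δ * (2 * N)}
        ≤ ENNReal.ofReal (C * (δ * ε ^ m * N ^ (d - m))) := by
  obtain ⟨C, hC, e, he, hei, H⟩ := volA L i h
  refine ⟨C, hC, fun N ε δ hN hε hδ a b => ?_⟩
  refine le_trans (measure_mono ?_)
    (H N ε δ hN hε hδ i (fun k => if k = i then a else N / 2) b)
  rintro x ⟨h1, h2, h3⟩
  refine ⟨fun k _ => ?_, fun j => ?_⟩
  · by_cases hk : k = i
    · subst hk; simpa using h3
    · simpa [hk] using h1 k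
  · simpa [hei j] using h2 j

theorem volC {m d : ℕ} (L : Matrix (Fin m) (Fin d) ℝ) (i : Fin d)
    (h : ∀ y : Fin m → ℝ, ∃ x : Fin d → ℝ, x i = 0 ∧ L.mulVec x = y) :
    ∃ C : ℝ, 0 ≤ C ∧
      ∀ N ε δ : ℝ, 0 ≤ N → 0 ≤ ε → 0 ≤ δ → ∀ (j0 : Fin m) (a : ℝ) (b : Fin m → ℝ),
        volume {x : Fin d → ℝ | (∀ k, |x k - N / 2| ≤ 2 * N) ∧
          (∀ j, |L.mulVec x j - b j| ≤ 2 * ε) ∧ |L.mulVec x j0 - a| ≤ δ * (2 * ε)}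
        ≤ ENNReal.ofReal (C * (δ * ε ^ m * N ^ (d - m))) := by
  obtain ⟨C, hC, e, he, hei, H⟩ := volA L i h
  refine ⟨C, hC, fun N ε δ hN hε hδ j0 a b => ?_⟩
  refine le_trans (measure_mono ?_)
    (H N ε δ hN hε hδ (e j0) (fun k => N / 2) (fun j => if j = j0 then a else b j))
  rintro x ⟨h1, h2, h3⟩
  refine ⟨fun k hk => ?_, fun j => ?_⟩
  · have : k ≠ e j0 := by rintro rfl; exact hk ⟨_, rfl⟩
    simpa [this] using h1 k
  · by_cases hj : j = j0
    · subst hj; simpa using h3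
    · have : e j ≠ e j0 := fun h => hj (he h)
      simpa [hj, this] using h2 j

/-- The set whose volume is the integral. -/
def solSet {m d : ℕ} (L : Matrix (Fin m) (Fin d) ℝ) (v : Fin m → ℝ) (p q η : ℝ) :
    Set (Fin d → ℝ) :=
  {x | (∀ k, p ≤ x k ∧ x k ≤ q) ∧ ∀ j, |L.mulVec x j + v j| ≤ η}

theorem solSet_meas {m d : ℕ} (L : Matrix (Fin m) (Fin d) ℝ) (v : Fin m → ℝ) (p q η : ℝ) :
    MeasurableSet {x : Fin d → ℝ | ∀ j, |L.mulVec x j + v j| ≤ η} := by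
  have hc : Continuous fun x : Fin d → ℝ => L.mulVec x := by
    fun_prop
  rw [Set.ofPred_forall]
  refine MeasurableSet.iInter fun j => (IsClosed.measurableSet ?_)
  refine isClosed_le ?_ continuous_const
  exact ((((continuous_apply j).comp hc).add continuous_const)).abs

theorem int_eq {m d : ℕ} (L : Matrix (Fin m) (Fin d) ℝ) (v : Fin m → ℝ) (p q η : ℝ) :
    ∫ x in Set.Icc (fun _ => p : Fin d → ℝ) (fun _ => q), boxInd m η (L.mulVec x + v)
      = volume.real (solSet L v p q η) := by
  have h1 : (fun x : Fin d → ℝ => boxInd m η (L.mulVec x + v)) =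
      Set.indicator {x : Fin d → ℝ | ∀ j, |L.mulVec x j + v j| ≤ η} (fun _ => (1 : ℝ)) := by
    ext x
    simp [boxInd, Set.indicator]
  rw [h1, integral_indicator (solSet_meas L v p q η)]
  rw [Measure.restrict_restrict (solSet_meas L v p q η)]
  simp only [integral_const, smul_eq_mul, mul_one, measureReal_restrict_apply_univ]
  congr 1
  ext x
  simp only [solSet, Set.mem_inter_iff, Set.mem_setOf_eq, Set.mem_Icc, Pi.le_def, forall_and]
  tauto

theorem solSet_fin {m d : ℕ} (L : Matrix (Fin m) (Fin d) ℝ) (v : Fin m → ℝ) (p q η : ℝ) :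
    volume (solSet L v p q η) ≠ ⊤ := by
  refine ne_top_of_le_ne_top (b := volume (Set.Icc (fun _ => p : Fin d → ℝ) (fun _ => q))) ?_
    (measure_mono ?_)
  · exact isCompact_Icc.measure_ne_top
  · intro x hx
    exact ⟨fun k => (hx.1 k).1, fun k => (hx.1 k).2⟩

theorem abs_real_sub_le {α : Type*} [MeasurableSpace α] (μ : Measure α) (E F D : Set α)
    (hE : μ E ≠ ⊤) (hF : μ F ≠ ⊤) (K : ℝ) (hK : 0 ≤ K) (hD : μ D ≤ ENNReal.ofReal K)
    (h1 : E ⊆ F ∪ D) (h2 : F ⊆ E ∪ D) : |μ.real E - μ.real F| ≤ K := by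
  have hDf : μ D ≠ ⊤ := ne_top_of_le_ne_top ENNReal.ofReal_ne_top hD
  have hDr : μ.real D ≤ K := ENNReal.toReal_le_of_le_ofReal hK hD
  have e1 : μ.real E ≤ μ.real F + μ.real D :=
    (measureReal_mono h1 (measure_union_ne_top hF hDf)).trans (measureReal_union_le _ _)
  have e2 : μ.real F ≤ μ.real E + μ.real D :=
    (measureReal_mono h2 (measure_union_ne_top hE hDf)).trans (measureReal_union_le _ _)
  rw [abs_le]; constructor <;> linarith

theorem stmt17 (m d : ℕ) (hm : 0 < m) (hd : m + 1 ≤ d)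
    (L : Matrix (Fin m) (Fin d) ℝ)
    (hsurj : Function.Surjective L.mulVec)
    (hirr : ∀ α : Fin m → ℝ, α ≠ 0 → ∃ j, ∀ k : ℤ, Matrix.vecMul α L j ≠ (k : ℝ))
    (hcoord : ∀ i : Fin d, ∀ y : Fin m → ℝ, ∃ x : Fin d → ℝ, x i = 0 ∧ L.mulVec x = y) :
    ∃ A : ℝ, ∀ N : ℕ, 1 ≤ N → ∀ ε : ℝ, 0 < ε → ∀ δ : ℝ, 0 < δ → δ < 1 / 2 →
      ∀ v : Fin m → ℝ, ∀ s : ℝ, (s = 1 ∨ s = -1) →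
        |(∫ x in Set.Icc (fun _ => s * δ * N : Fin d → ℝ) (fun _ => (1 - s * δ) * N),
              boxInd m (ε * (1 - s * δ)) (L.mulVec x + v))
          - ∫ x in Set.Icc (0 : Fin d → ℝ) (fun _ => (N : ℝ)),
              boxInd m ε (L.mulVec x + v)|
        ≤ A * δ * ε ^ m * (N : ℝ) ^ (d - m) + A * ε ^ (m + 1) * (N : ℝ) ^ (d - m - 1) := by
  classical
  choose CB hCB HB using fun i => volB L i (hcoord i)
  obtain ⟨CC, hCC, HC⟩ := volC L ⟨0, by omega⟩ (hcoord _)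
  refine ⟨2 * ∑ i, CB i + 2 * (m * CC), ?_⟩
  have hA : 0 ≤ 2 * ∑ i, CB i + 2 * (m * CC) := by
    have := Finset.sum_nonneg fun i (_ : i ∈ Finset.univ) => hCB i
    positivity
  set A := 2 * ∑ i, CB i + 2 * (m * CC) with hAdef
  intro N hN ε hε δ hδ hδ2 v s hs
  have hN0 : (0 : ℝ) < N := by exact_mod_cast hN
  have hz : (0 : Fin d → ℝ) = fun _ => (0 : ℝ) := rfl
  rw [hz, int_eq, int_eq]
  set P : ℝ := δ * ε ^ m * (N : ℝ) ^ (d - m) with hP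
  have hP0 : 0 ≤ P := by positivity
  have hgoal : A * P ≤ A * δ * ε ^ m * (N : ℝ) ^ (d - m)
      + A * ε ^ (m + 1) * (N : ℝ) ^ (d - m - 1) := by
    have : 0 ≤ A * ε ^ (m + 1) * (N : ℝ) ^ (d - m - 1) := by positivity
    rw [hP]; nlinarith
  refine le_trans ?_ hgoal
  let DB : Fin d → ℝ → Set (Fin d → ℝ) := fun i a =>
    {x : Fin d → ℝ | (∀ k, |x k - N / 2| ≤ 2 * N) ∧
          (∀ j, |L.mulVec x j - (- v j)| ≤ 2 * ε) ∧ |x i - a| ≤ δ * (2 * N)}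
  let DC : Fin m → ℝ → Set (Fin d → ℝ) := fun j0 a =>
    {x : Fin d → ℝ | (∀ k, |x k - N / 2| ≤ 2 * N) ∧
          (∀ j, |L.mulVec x j - (- v j)| ≤ 2 * ε) ∧ |L.mulVec x j0 - a| ≤ δ * (2 * ε)}
  let D : Set (Fin d → ℝ) := (⋃ i, (DB i 0 ∪ DB i N)) ∪ ⋃ j, (DC j (-v j + ε) ∪ DC j (-v j - ε))
  have hDvol : volume D ≤ ENNReal.ofReal (A * P) := by
    have hB : ∀ i a, volume (DB i a) ≤ ENNReal.ofReal (CB i * P) := fun i a =>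
      HB i N ε δ hN0.le hε.le hδ.le a _
    have hC : ∀ j a, volume (DC j a) ≤ ENNReal.ofReal (CC * P) := fun j a =>
      HC N ε δ hN0.le hε.le hδ.le j a _
    have e1 : volume (⋃ i, (DB i 0 ∪ DB i N)) ≤ ENNReal.ofReal (∑ i, 2 * (CB i * P)) := by
      refine (measure_iUnion_fintype_le _ _).trans ?_
      rw [ENNReal.ofReal_sum_of_nonneg (fun i _ => by have := hCB i; positivity)]
      refine Finset.sum_le_sum fun i _ => (measure_union_le _ _).trans ?_
      have := hCB i
      rw [two_mul, ENNReal.ofReal_add (by positivity) (by positivity)]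
      exact add_le_add (hB _ _) (hB _ _)
    have e2 : volume (⋃ j, (DC j (-v j + ε) ∪ DC j (-v j - ε)))
        ≤ ENNReal.ofReal (∑ j : Fin m, 2 * (CC * P)) := by
      refine (measure_iUnion_fintype_le _ _).trans ?_
      rw [ENNReal.ofReal_sum_of_nonneg (fun i _ => by positivity)]
      refine Finset.sum_le_sum fun i _ => (measure_union_le _ _).trans ?_
      rw [two_mul, ENNReal.ofReal_add (by positivity) (by positivity)]
      exact add_le_add (hC _ _) (hC _ _)
    refine (measure_union_le _ _).trans ((add_le_add e1 e2).trans ?_)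
    rw [← ENNReal.ofReal_add]
    · apply ENNReal.ofReal_le_ofReal
      rw [← Finset.mul_sum, ← Finset.sum_mul]
      simp only [Finset.sum_const, Finset.card_univ, Fintype.card_fin, nsmul_eq_mul, hAdef]
      apply le_of_eq; ring
    · exact Finset.sum_nonneg fun i _ => by have := hCB i; positivity
    · exact Finset.sum_nonneg fun i _ => by positivity
  have hδN : δ * N < 1 / 2 * N := by nlinarith
  have hδN0 : 0 < δ * N := by positivity
  have hδε : δ * ε < 1 / 2 * ε := by nlinarith
  have hδε0 : 0 < δ * ε := by positivity
  -- general covering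
  have cover : ∀ p q η p' q' η' : ℝ, |p| ≤ δ * N → |p'| ≤ δ * N → |q - N| ≤ δ * N →
      |q' - N| ≤ δ * N → |η - ε| ≤ δ * ε → |η' - ε| ≤ δ * ε →
      solSet L v p q η ⊆ solSet L v p' q' η' ∪ D := by
    intro p q η p' q' η' h1 h2 h3 h4 h5 h6 x hx
    rw [abs_le] at h1 h2 h3 h4 h5 h6
    by_cases hx' : x ∈ solSet L v p' q' η'
    · exact Or.inl hx'
    right
    have b1 : ∀ k, |x k - N / 2| ≤ 2 * N := fun k => by
      have := hx.1 k
      rw [abs_le]; constructor <;> linarith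
    have b2 : ∀ j, |L.mulVec x j - (- v j)| ≤ 2 * ε := fun j => by
      have := hx.2 j
      rw [sub_neg_eq_add]; linarith
    by_cases hc : ∀ k, p' ≤ x k ∧ x k ≤ q'
    · have : ¬ ∀ j, |L.mulVec x j + v j| ≤ η' := fun h => hx' ⟨hc, h⟩
      push Not at this
      obtain ⟨j, hj⟩ := this
      right
      refine Set.mem_iUnion.2 ⟨j, ?_⟩
      have hj2 := hx.2 j
      rcases le_total 0 (L.mulVec x j + v j) with h0 | h0
      · rw [abs_of_nonneg h0] at hj hj2
        refine Or.inl ⟨b1, b2, ?_⟩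
        rw [abs_le]; constructor <;> linarith
      · rw [abs_of_nonpos h0] at hj hj2
        refine Or.inr ⟨b1, b2, ?_⟩
        rw [abs_le]; constructor <;> linarith
    · push Not at hc
      obtain ⟨k, hk⟩ := hc
      have hxk := hx.1 k
      left
      refine Set.mem_iUnion.2 ⟨k, ?_⟩
      by_cases hk1 : p' ≤ x k
      · have := hk hk1
        refine Or.inr ⟨b1, b2, ?_⟩
        rw [abs_le]; constructor <;> linarith
      · push Not at hk1
        refine Or.inl ⟨b1, b2, ?_⟩
        rw [abs_le]; constructor <;> linarith
  have t1 : |s * δ * N| ≤ δ * N := by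
    rw [abs_le]; rcases hs with rfl | rfl <;> constructor <;> linarith
  have t2 : |(1 - s * δ) * N - N| ≤ δ * N := by
    rw [abs_le]; rcases hs with rfl | rfl <;> constructor <;> linarith
  have t3 : |ε * (1 - s * δ) - ε| ≤ δ * ε := by
    rw [abs_le]; rcases hs with rfl | rfl <;> constructor <;> linarith
  have u1 : |(0 : ℝ)| ≤ δ * N := by simpa using hδN0.le
  have u2 : |(N : ℝ) - N| ≤ δ * N := by simpa using hδN0.le
  have u3 : |ε - ε| ≤ δ * ε := by simpa using hδε0.le
  exact abs_real_sub_le volume _ _ D (solSet_fin _ _ _ _ _) (solSet_fin _ _ _ _ _) _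
    (by positivity) hDvol (cover _ _ _ _ _ _ t1 u1 t2 u2 t3 u3)
    (cover _ _ _ _ _ _ u1 t1 u2 t2 u3 t3)
end
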